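/- arXiv:math/0703666 — 2 statements merged into one kernel-verified Lean document; each statement's English description precedes it below -/
import Mathlib

section
/- For each braid word w in the generators σ_1^{±1},...,σ_{n-1}^{±1}, there exist unique positive braid words u, v such that w right-redresses to u v⁻¹; in particular, right redressing of any braid word terminates. -/
/-- Relations of the braid group presentation. -/
def braidRels (n : ℕ) : Set (FreeGroup (Fin (n - 1))) :=
  {r | (∃ i j : Fin (n - 1), (i : ℕ) + 2 ≤ (j : ℕ) ∧
          r = FreeGroup.of i * FreeGroup.of j * (FreeGroup.of j * FreeGroup.of i)⁻¹) ∨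
       (∃ i j : Fin (n - 1), (i : ℕ) + 1 = (j : ℕ) ∧
          r = FreeGroup.of i * FreeGroup.of j * FreeGroup.of i *
              (FreeGroup.of j * FreeGroup.of i * FreeGroup.of j)⁻¹)}

/-- Artin's braid group `B_n`. -/
def BraidGroup (n : ℕ) : Type := PresentedGroup (braidRels n)

instance (n : ℕ) : Group (BraidGroup n) :=
  inferInstanceAs (Group (PresentedGroup (braidRels n)))

/-- The Artin generator `σ_{i+1}` (0-indexed `i`). -/
def braidGen {n : ℕ} (i : Fin (n - 1)) : BraidGroup n := PresentedGroup.of i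

/-- The positive braid monoid `B_n^+` (submonoid generated by the `σ_i`). -/
def PosBraid (n : ℕ) : Submonoid (BraidGroup n) :=
  Submonoid.closure (Set.range (braidGen (n := n)))

/-- `x` left-divides `y` (with positive quotient). -/
def DividesL {n : ℕ} (x y : BraidGroup n) : Prop := ∃ z ∈ PosBraid n, y = x * z

/-- `x` right-divides `y` (with positive quotient). -/
def DividesR {n : ℕ} (x y : BraidGroup n) : Prop := ∃ z ∈ PosBraid n, y = z * x

/-- Auxiliary: `deltaAux n m` is the Garside element `Δ_m` viewed inside `B_n`. -/
def deltaAux (n : ℕ) : ℕ → BraidGroup n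
  | 0 => 1
  | m + 1 =>
      ((List.range m).map (fun i =>
        if h : i < n - 1 then braidGen ⟨i, h⟩ else 1)).prod * deltaAux n m

/-- Garside's element `Δ_n = σ_1⋯σ_{n-1} Δ_{n-1}`. -/
def braidDelta (n : ℕ) : BraidGroup n := deltaAux n n

/-- A simple braid: a (positive) divisor of `Δ_n`. -/
def Simple {n : ℕ} (s : BraidGroup n) : Prop :=
  s ∈ PosBraid n ∧ DividesL s (braidDelta n)

/-- Normality of a pair, in the divisor form: every `σ_i` left-dividing `t`
right-divides `s`. -/
def NormalPair {n : ℕ} (s t : BraidGroup n) : Prop :=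
  ∀ i : Fin (n - 1), DividesL (braidGen i) t → DividesR (braidGen i) s

/-- `g` is the left gcd of `x` and `y` in `B_n^+`. -/
def IsLeftGcd {n : ℕ} (g x y : BraidGroup n) : Prop :=
  g ∈ PosBraid n ∧ DividesL g x ∧ DividesL g y ∧
    ∀ d ∈ PosBraid n, DividesL d x → DividesL d y → DividesL d g

/-- Normality of a pair, in the gcd form: `s = gcd_L(st, Δ_n)`. -/
def GNormal {n : ℕ} (s t : BraidGroup n) : Prop :=
  IsLeftGcd s (s * t) (braidDelta n)

/-- `u` is the left lcm of `x` and `y`. -/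
def IsLeftLcm {n : ℕ} (u x y : BraidGroup n) : Prop :=
  DividesR x u ∧ DividesR y u ∧ ∀ v, DividesR x v → DividesR y v → DividesR u v

/-- The position `i` inside `Fin n`. -/
def finL {n : ℕ} (i : Fin (n - 1)) : Fin n := ⟨i, by have := i.isLt; omega⟩

/-- The position `i + 1` inside `Fin n`. -/
def finR {n : ℕ} (i : Fin (n - 1)) : Fin n := ⟨(i : ℕ) + 1, by have := i.isLt; omega⟩

/-- `i` is a descent of the permutation `f` : `f(i) > f(i+1)`. -/
def Descent {n : ℕ} (f : Equiv.Perm (Fin n)) (i : Fin (n - 1)) : Prop :=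
  f (finR i) < f (finL i)

/-- `i` is a recoil of the permutation `f` : `f⁻¹(i) > f⁻¹(i+1)`. -/
def Recoil {n : ℕ} (f : Equiv.Perm (Fin n)) (i : Fin (n - 1)) : Prop :=
  f⁻¹ (finR i) < f⁻¹ (finL i)

/-- Braid words: letters are a generator index together with a sign
(`true` = positive letter `σ_i`, `false` = negative letter `σ_i⁻¹`). -/
abbrev BWord (n : ℕ) := List (Fin (n - 1) × Bool)

/-- The braid represented by a braid word. -/
def evalWord {n : ℕ} (w : BWord n) : BraidGroup n :=
  (w.map (fun x => if x.2 then braidGen x.1 else (braidGen x.1)⁻¹)).prod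

/-- One step of right redressing. -/
inductive Redr1 {n : ℕ} : BWord n → BWord n → Prop where
  | del (u v : BWord n) (i : Fin (n - 1)) :
      Redr1 (u ++ [(i, false), (i, true)] ++ v) (u ++ v)
  | far (u v : BWord n) (i j : Fin (n - 1))
      (h : (i : ℕ) + 2 ≤ (j : ℕ) ∨ (j : ℕ) + 2 ≤ (i : ℕ)) :
      Redr1 (u ++ [(i, false), (j, true)] ++ v) (u ++ [(j, true), (i, false)] ++ v)
  | adj (u v : BWord n) (i j : Fin (n - 1))
      (h : (i : ℕ) + 1 = (j : ℕ) ∨ (j : ℕ) + 1 = (i : ℕ)) :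
      Redr1 (u ++ [(i, false), (j, true)] ++ v)
            (u ++ [(j, true), (i, true), (j, false), (i, false)] ++ v)

namespace Redr

/-- The right-hand sides of the rewriting rules. -/
inductive Rule {n : ℕ} : Fin (n - 1) → Fin (n - 1) → BWord n → Prop where
  | del (i) : Rule i i []
  | far (i j : Fin (n - 1)) (h : (i : ℕ) + 2 ≤ (j : ℕ) ∨ (j : ℕ) + 2 ≤ (i : ℕ)) :
      Rule i j [(j, true), (i, false)]
  | adj (i j : Fin (n - 1)) (h : (i : ℕ) + 1 = (j : ℕ) ∨ (j : ℕ) + 1 = (i : ℕ)) :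
      Rule i j [(j, true), (i, true), (j, false), (i, false)]

theorem Rule.unique {n : ℕ} {i j : Fin (n - 1)} {r s : BWord n} (h : Rule i j r)
    (h' : Rule i j s) : r = s := by
  cases h <;> cases h' <;> first | rfl | omega

theorem Rule.exists {n : ℕ} (i j : Fin (n - 1)) : ∃ r, Rule i j r := by
  by_cases h : i = j
  · subst h; exact ⟨_, .del i⟩
  · by_cases h2 : (i : ℕ) + 1 = (j : ℕ) ∨ (j : ℕ) + 1 = (i : ℕ)
    · exact ⟨_, .adj i j h2⟩
    · refine ⟨_, .far i j ?_⟩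
      have : (i : ℕ) ≠ j := fun h3 => h (Fin.ext h3)
      omega

theorem Rule.step {n : ℕ} {i j : Fin (n - 1)} {r : BWord n} (h : Rule i j r) (u v : BWord n) :
    Redr1 (u ++ [(i, false), (j, true)] ++ v) (u ++ r ++ v) := by
  cases h with
  | del => simpa using Redr1.del u v i
  | far _ h => exact Redr1.far u v i j h
  | adj _ h => exact Redr1.adj u v i j h

theorem step_iff {n : ℕ} {a b : BWord n} : Redr1 a b ↔
    ∃ u v i j r, Rule i j r ∧ a = u ++ [(i, false), (j, true)] ++ v ∧ b = u ++ r ++ v := by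
  constructor
  · intro h
    cases h with
    | del u v i => exact ⟨u, v, i, i, [], .del i, rfl, by simp⟩
    | far u v i j h => exact ⟨u, v, i, j, _, .far i j h, rfl, rfl⟩
    | adj u v i j h => exact ⟨u, v, i, j, _, .adj i j h, rfl, rfl⟩
  · rintro ⟨u, v, i, j, r, h, rfl, rfl⟩
    exact h.step u v

theorem diamond_aux {n : ℕ} {i j i' j' : Fin (n - 1)} {r r' : BWord n} (h : Rule i j r)
    (h' : Rule i' j' r') (u v u' v' t : BWord n) (ht : u' = u ++ t)
    (e : u ++ [(i, false), (j, true)] ++ v = u' ++ [(i', false), (j', true)] ++ v') :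
    ∃ d, Relation.ReflGen Redr1 (u ++ r ++ v) d ∧ Relation.ReflGen Redr1 (u' ++ r' ++ v') d := by
  subst ht
  match t with
  | [] =>
    simp at e
    obtain ⟨rfl, rfl, rfl⟩ := e
    rw [h.unique h']
    exact ⟨_, .refl, by simpa using .refl⟩
  | [x] => simp at e
  | x :: y :: t =>
    simp at e
    obtain ⟨rfl, rfl, rfl⟩ := e
    refine ⟨u ++ r ++ t ++ r' ++ v', .single ?_, .single ?_⟩
    · have := h'.step (u ++ r ++ t) v'
      simpa using this
    · have := h.step u (t ++ r' ++ v')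
      simpa using this

theorem diamond {n : ℕ} (a b c : BWord n) (hb : Redr1 a b) (hc : Redr1 a c) :
    ∃ d, Relation.ReflGen Redr1 b d ∧ Relation.ReflTransGen Redr1 c d := by
  obtain ⟨u, v, i, j, r, h, rfl, rfl⟩ := step_iff.1 hb
  obtain ⟨u', v', i', j', r', h', e, rfl⟩ := step_iff.1 hc
  have e2 := e
  rw [List.append_assoc, List.append_assoc, List.append_eq_append_iff] at e2
  rcases e2 with ⟨t, ht, -⟩ | ⟨t, ht, -⟩
  · obtain ⟨d, h1, h2⟩ := diamond_aux h h' u v u' v' t ht e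
    exact ⟨d, h1, h2.to_reflTransGen⟩
  · obtain ⟨d, h1, h2⟩ := diamond_aux h' h u' v' u v t ht e.symm
    exact ⟨d, h2, h1.to_reflTransGen⟩

/-- Positive word followed by negative word is irreducible. -/
theorem normal {n : ℕ} {u v b : BWord n} (hu : ∀ x ∈ u, x.2 = true) (hv : ∀ x ∈ v, x.2 = false) :
    ¬ Redr1 (u ++ v) b := by
  intro h
  obtain ⟨a, c, i, j, r, -, e, -⟩ := step_iff.1 h
  have hp : (u ++ v).Pairwise (fun x y => x.2 = false → y.2 = false) := by
    rw [List.pairwise_append]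
    refine ⟨?_, ?_, ?_⟩
    · exact List.Pairwise.imp_of_mem (R := fun _ _ => True)
        (fun {x y} hx _ _ h => by simp [hu x hx] at h) (List.pairwise_of_forall (by simp))
    · exact List.Pairwise.imp_of_mem (R := fun _ _ => True)
        (fun {x y} _ hy _ _ => hv y hy) (List.pairwise_of_forall (by simp))
    · intro x _ y hy _; exact hv y hy
  rw [e] at hp
  simp [List.pairwise_append] at hp

theorem normal_star {n : ℕ} {u v b : BWord n} (hu : ∀ x ∈ u, x.2 = true)
    (hv : ∀ x ∈ v, x.2 = false) (h : Relation.ReflTransGen Redr1 (u ++ v) b) : b = u ++ v := by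
  rcases h.cases_head with h | ⟨c, h, -⟩
  · exact h.symm
  · exact absurd h (normal hu hv)

theorem split_unique {n : ℕ} : ∀ {u v u' v' : BWord n}, (∀ x ∈ u, x.2 = true) →
    (∀ x ∈ v, x.2 = false) → (∀ x ∈ u', x.2 = true) → (∀ x ∈ v', x.2 = false) →
    u ++ v = u' ++ v' → u = u' ∧ v = v'
  | [], v, [], v', _, _, _, _, e => by simpa using e
  | [], v, x :: u', v', _, hv, hu', _, e => by
    have h1 := hu' x (by simp)
    have h2 := hv x (by simp at e; simp [e])
    simp [h1] at h2
  | x :: u, v, [], v', hu, _, _, hv', e => by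
    have h1 := hu x (by simp)
    have h2 := hv' x (by simp at e; simp [← e])
    simp [h1] at h2
  | x :: u, v, y :: u', v', hu, hv, hu', hv', e => by
    simp only [List.cons_append, List.cons.injEq] at e
    obtain ⟨rfl, e⟩ := e
    obtain ⟨rfl, rfl⟩ := split_unique (fun x hx => hu x (by simp [hx])) hv
      (fun x hx => hu' x (by simp [hx])) hv' e
    simp

theorem split_or {n : ℕ} (w : BWord n) :
    (∃ u v, (∀ x ∈ u, x.2 = true) ∧ (∀ x ∈ v, x.2 = false) ∧ w = u ++ v) ∨
    ∃ u v i j, w = u ++ [(i, false), (j, true)] ++ v := by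
  induction w with
  | nil => exact .inl ⟨[], [], by simp⟩
  | cons x w ih =>
    rcases ih with ⟨u, v, hu, hv, rfl⟩ | ⟨u, v, i, j, rfl⟩
    · obtain ⟨i, b⟩ := x
      cases b
      · cases u with
        | nil => exact .inl ⟨[], (i, false) :: v, by simp, by simpa using hv, rfl⟩
        | cons y u =>
          obtain ⟨j, b⟩ := y
          have : b = true := hu (j, b) (by simp)
          subst this
          exact .inr ⟨[], u ++ v, i, j, by simp⟩
      · exact .inl ⟨(i, true) :: u, v, by simpa using hu, hv, rfl⟩
    · exact .inr ⟨x :: u, v, i, j, by simp⟩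

/-- Action of an elementary transposition. -/
def act (g : ℕ → ℕ) (i : ℕ) : ℕ → ℕ := fun k => g (Equiv.swap i (i + 1) k)

theorem act_act (g : ℕ → ℕ) (i : ℕ) : act (act g i) i = g := by
  funext k; simp [act]

theorem act_apply (g : ℕ → ℕ) (i k : ℕ) :
    act g i k = if k = i then g (i + 1) else if k = i + 1 then g i else g k := by
  simp only [act, Equiv.swap_apply_def]
  split_ifs <;> rfl

/-- Endpoint of the path labelled by a word. -/
def app {n : ℕ} (g : ℕ → ℕ) : BWord n → (ℕ → ℕ)
  | [] => g
  | x :: w => app (act g x.1) w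

/-- Positive letters climb, negative letters descend. -/
def Asc (g : ℕ → ℕ) (i : ℕ) (b : Bool) : Prop :=
  if b then g i < g (i + 1) else g (i + 1) < g i

def Valid {n : ℕ} (g : ℕ → ℕ) : BWord n → Prop
  | [] => True
  | x :: w => Asc g x.1 x.2 ∧ Valid (act g x.1) w

def phi (n : ℕ) (g : ℕ → ℕ) : ℕ := ∑ k ∈ Finset.range n, k * g k

def wt {n : ℕ} (g : ℕ → ℕ) : BWord n → ℕ
  | [] => 0
  | x :: w => 4 ^ phi n (act g x.1) + wt (act g x.1) w

theorem app_append {n : ℕ} (u v : BWord n) (g) : app g (u ++ v) = app (app g u) v := by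
  induction u generalizing g with
  | nil => rfl
  | cons x u ih => exact ih _

theorem valid_append {n : ℕ} (u v : BWord n) (g) :
    Valid g (u ++ v) ↔ Valid g u ∧ Valid (app g u) v := by
  induction u generalizing g with
  | nil => simp [Valid, app]
  | cons x u ih => simp [Valid, app, ih, and_assoc]

theorem wt_append {n : ℕ} (u v : BWord n) (g) : wt g (u ++ v) = wt g u + wt (app g u) v := by
  induction u generalizing g with
  | nil => simp [wt, app]
  | cons x u ih => simp [wt, app, ih, add_assoc]

theorem phi_lt (n : ℕ) (g : ℕ → ℕ) (i : ℕ) (hi : i + 1 < n) (h : g i < g (i + 1)) :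
    phi n (act g i) < phi n g := by
  unfold phi
  have h1 : i ∈ Finset.range n := by simp; omega
  have h2 : i + 1 ∈ (Finset.range n).erase i := by simp; omega
  rw [← Finset.add_sum_erase _ _ h1, ← Finset.add_sum_erase _ _ h2,
    ← Finset.add_sum_erase _ (fun k => k * g k) h1, ← Finset.add_sum_erase _ (fun k => k * g k) h2]
  have h3 : ∑ k ∈ ((Finset.range n).erase i).erase (i + 1), k * act g i k =
      ∑ k ∈ ((Finset.range n).erase i).erase (i + 1), k * g k := by
    refine Finset.sum_congr rfl fun k hk => ?_
    simp at hk
    rw [act_apply, if_neg hk.2.1, if_neg hk.1]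
  rw [h3]
  simp [act_apply]
  nlinarith

/-- Flip and reverse. -/
def inv {n : ℕ} (w : BWord n) : BWord n := (w.map (fun x => (x.1, !x.2))).reverse

theorem inv_inv {n : ℕ} (w : BWord n) : inv (inv w) = w := by
  simp [inv, Function.comp_def]

theorem asc_flip {g : ℕ → ℕ} {i : ℕ} {b : Bool} (h : Asc g i b) : Asc (act g i) i (!b) := by
  cases b <;> simpa [Asc, act_apply] using h

theorem app_inv {n : ℕ} (w : BWord n) (g) : app (app g w) (inv w) = g := by
  induction w generalizing g with
  | nil => rfl
  | cons x w ih =>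
    have : inv (x :: w) = inv w ++ [(x.1, !x.2)] := by simp [inv]
    rw [this, app_append]
    simp [app, ih, act_act]

theorem valid_inv {n : ℕ} (w : BWord n) (g) (h : Valid g w) : Valid (app g w) (inv w) := by
  induction w generalizing g with
  | nil => trivial
  | cons x w ih =>
    have : inv (x :: w) = inv w ++ [(x.1, !x.2)] := by simp [inv]
    rw [this, valid_append, app]
    refine ⟨ih _ h.2, ?_⟩
    rw [app_inv]
    exact ⟨asc_flip h.1, trivial⟩

theorem act_far (g : ℕ → ℕ) {i j : ℕ} (h : i + 2 ≤ j ∨ j + 2 ≤ i) :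
    act (act g i) j = act (act g j) i := by
  funext k
  simp only [act_apply]
  split_ifs <;> first | rfl | omega

theorem act_adj (g : ℕ → ℕ) {i j : ℕ} (h : i + 1 = j ∨ j + 1 = i) :
    act (act (act g i) j) i = act (act (act g j) i) j := by
  funext k
  rcases h with rfl | rfl <;> simp only [act_apply] <;>
  split_ifs <;> first | rfl | omega

theorem pow_lt4 {a b : ℕ} (h : a < b) : 4 * 4 ^ a ≤ 4 ^ b := by
  rw [← pow_succ']; exact Nat.pow_le_pow_right (by norm_num) h

theorem rule_valid {n : ℕ} {i j : Fin (n - 1)} {r : BWord n} (hr : Rule i j r) (g : ℕ → ℕ)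
    (hg : Valid g ([(i, false), (j, true)] : BWord n)) :
    Valid g r ∧ app g r = app g ([(i, false), (j, true)] : BWord n) ∧
      wt g r < wt g ([(i, false), (j, true)] : BWord n) := by
  obtain ⟨h, rfl⟩ : ∃ h, g = act h i := ⟨act g i, (act_act _ _).symm⟩
  have hi := i.isLt
  have hj := j.isLt
  simp only [Valid, act_act, Asc, if_true, and_true] at hg
  obtain ⟨hgi, hgj⟩ := hg
  replace hgi : h i < h (i + 1) := by simpa [act_apply] using hgi
  cases hr with
  | del => simp [Valid, app, wt, act_act]
  | far _ hij =>
    have hp1 := phi_lt n h j (by omega) hgj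
    have hc := act_far h hij
    have e1 : act h i j = h j := by rw [act_apply, if_neg (by omega), if_neg (by omega)]
    have e2 : act h i (j + 1) = h (j + 1) := by
      rw [act_apply, if_neg (by omega), if_neg (by omega)]
    have e3 : act h j i = h i := by rw [act_apply, if_neg (by omega), if_neg (by omega)]
    have e4 : act h j (i + 1) = h (i + 1) := by
      rw [act_apply, if_neg (by omega), if_neg (by omega)]
    have hp2 := phi_lt n (act h j) i (by omega) (by omega)
    refine ⟨?_, ?_, ?_⟩
    · simp only [Valid, Asc, hc, act_act]
      simp [e1, e2, hgj]
      simpa [act_apply (act h j) i, e3, e4] using hgi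
    · simp only [app, hc, act_act]
    · simp only [wt, hc, act_act]
      have := pow_lt4 (hp2.trans hp1)
      have := pow_pos (show 0 < 4 by norm_num) (phi n (act (act h j) i))
      omega
  | adj _ hij =>
    have hc := act_adj h hij
    have a1 : act h i j < act h i (j + 1) := by
      rcases hij with hij | hij <;> simp [← hij, act_apply] at * <;> split_ifs <;> omega
    have a2 : act (act h i) j i < act (act h i) j (i + 1) := by
      rcases hij with hij | hij <;> simp [← hij, act_apply] at * <;> split_ifs <;> omega
    have a3 : act h j i < act h j (i + 1) := by
      rcases hij with hij | hij <;> simp [← hij, act_apply] at * <;> split_ifs <;> omega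
    have a4 : act (act h j) i j < act (act h j) i (j + 1) := by
      rcases hij with hij | hij <;> simp [← hij, act_apply] at * <;> split_ifs <;> omega
    have p0 := pow_lt4 (phi_lt n h i (by omega) hgi)
    have p1 := pow_lt4 (phi_lt n (act h i) j (by omega) a1)
    have p2 := pow_lt4 (phi_lt n _ i (by omega) a2)
    have p0' := pow_lt4 (phi_lt n h j (by omega) hgj)
    have p3 := pow_lt4 (phi_lt n _ i (by omega) a3)
    have := pow_pos (show 0 < 4 by norm_num) (phi n h)
    refine ⟨?_, ?_, ?_⟩
    · simp only [Valid, Asc, hc, act_act, if_true, and_true]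
      refine ⟨a1, a2, ?_, ?_⟩
      · simpa [act_apply (act (act h j) i) j] using a4
      · simpa [act_apply (act h j) i] using a3
    · simp only [app, hc, act_act]
    · simp only [wt, hc, act_act]
      rw [hc] at p2
      omega

/-- Termination for words tracing a path in the weak order. -/
theorem valid_term {n : ℕ} (N : ℕ) : ∀ (w : BWord n) (g : ℕ → ℕ), wt g w < N → Valid g w →
    ∃ u v, (∀ x ∈ u, x.2 = true) ∧ (∀ x ∈ v, x.2 = false) ∧
      Relation.ReflTransGen Redr1 w (u ++ v) ∧ Valid g (u ++ v) := by
  induction N with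
  | zero => intro w g h; omega
  | succ N ih =>
    intro w g hw hv
    rcases split_or w with ⟨u, v, hu, hv', rfl⟩ | ⟨u, v, i, j, rfl⟩
    · exact ⟨u, v, hu, hv', .refl, hv⟩
    · obtain ⟨r, hr⟩ := Rule.exists i j
      rw [valid_append, valid_append] at hv
      obtain ⟨h1, h2, h3⟩ := rule_valid hr _ hv.1.2
      obtain ⟨a, b, ha, hb, hs, hval⟩ := ih (u ++ r ++ v) g (by
        simp only [wt_append, app_append] at hw ⊢
        rw [h2]; omega) (by
        simp only [valid_append, app_append] at hv ⊢
        rw [h2]; exact ⟨⟨hv.1.1, h1⟩, hv.2⟩)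
      exact ⟨a, b, ha, hb, hs.head (hr.step u v), hval⟩

theorem swap_lt {i p q : ℕ} (h : p < q) (h' : ¬ (p = i ∧ q = i + 1)) :
    Equiv.swap i (i + 1) p < Equiv.swap i (i + 1) q := by
  simp only [Equiv.swap_apply_def]
  split_ifs <;> omega

theorem valid_transfer {n : ℕ} (w : BWord n) : ∀ (f g : ℕ → ℕ), (∀ x ∈ w, x.2 = true) →
    Function.Injective f → (∀ p q, p < q → f q < f p → g q < g p) → Valid g w → Valid f w := by
  induction w with
  | nil => intros; trivial
  | cons x w ih =>
    intro f g hpos hf hfg hv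
    have hx : x.2 = true := hpos x (by simp)
    have hg : g x.1 < g (x.1 + 1) := by simpa [Asc, hx] using hv.1
    have hlt : f x.1 < f (x.1 + 1) := by
      rcases lt_trichotomy (f x.1) (f (x.1 + 1)) with h | h | h
      · exact h
      · have := hf h; omega
      · have := hfg _ _ (by omega) h; omega
    refine ⟨by simpa [Asc, hx] using hlt, ih _ (act g x.1) (fun y hy => hpos y (by simp [hy]))
      (hf.comp (Equiv.injective _)) ?_ hv.2⟩
    intro p q hpq h
    by_cases hc : p = x.1 ∧ q = x.1 + 1
    · obtain ⟨rfl, rfl⟩ := hc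
      simpa [act_apply] using hg
    · exact hfg _ _ (swap_lt hpq hc) h

/-- Positive words representing simple braids. -/
def Simp {n : ℕ} (u : BWord n) : Prop := (∀ x ∈ u, x.2 = true) ∧ Valid id u

theorem simp_of_valid {n : ℕ} {u : BWord n} {g : ℕ → ℕ} (hu : ∀ x ∈ u, x.2 = true)
    (h : Valid g u) : Simp u :=
  ⟨hu, valid_transfer u id g hu Function.injective_id (fun p q h h' => by simp at h'; omega) h⟩

theorem step_ctx {n : ℕ} {a b : BWord n} (h : Relation.ReflTransGen Redr1 a b) (u v : BWord n) :
    Relation.ReflTransGen Redr1 (u ++ a ++ v) (u ++ b ++ v) := by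
  refine Relation.ReflTransGen.lift (p := Redr1) (f := fun x => u ++ x ++ v) ?_ _ _ h
  intro x y hxy
  obtain ⟨a, c, i, j, r, hr, rfl, rfl⟩ := step_iff.1 hxy
  have := hr.step (u ++ a) (c ++ v)
  simpa [Function.onFun] using this

theorem inv_pos {n : ℕ} {u : BWord n} (hu : ∀ x ∈ u, x.2 = false) : ∀ x ∈ inv u, x.2 = true := by
  intro x hx
  simp only [inv, List.mem_reverse, List.mem_map] at hx
  obtain ⟨y, hy, rfl⟩ := hx
  simp [hu y hy]

theorem inv_neg {n : ℕ} {u : BWord n} (hu : ∀ x ∈ u, x.2 = true) : ∀ x ∈ inv u, x.2 = false := by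
  intro x hx
  simp only [inv, List.mem_reverse, List.mem_map] at hx
  obtain ⟨y, hy, rfl⟩ := hx
  simp [hu y hy]

theorem simp_step {n : ℕ} {s t : BWord n} (hs : Simp s) (ht : Simp t) :
    ∃ t' s', Simp t' ∧ Simp s' ∧ Relation.ReflTransGen Redr1 (inv s ++ t) (t' ++ inv s') := by
  have hv : Valid (app id s) (inv s ++ t) := by
    rw [valid_append, app_inv]
    exact ⟨valid_inv _ _ hs.2, ht.2⟩
  obtain ⟨u, v, hu, hneg, hstar, hval⟩ := valid_term _ _ _ (Nat.lt_succ_self _) hv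
  rw [valid_append] at hval
  exact ⟨u, inv v, simp_of_valid hu hval.1, simp_of_valid (inv_pos hneg) (valid_inv _ _ hval.2),
    by rwa [inv_inv]⟩

theorem simp_list {n : ℕ} (Ps : List (BWord n)) : ∀ (s : BWord n), Simp s → (∀ p ∈ Ps, Simp p) →
    ∃ (Qs : List (BWord n)) (s' : BWord n), (∀ p ∈ Qs, Simp p) ∧ Simp s' ∧
      Relation.ReflTransGen Redr1 (inv s ++ Ps.flatten) (Qs.flatten ++ inv s') := by
  induction Ps with
  | nil => intro s hs _; exact ⟨[], s, by simp, hs, by simpa using .refl⟩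
  | cons t Ps ih =>
    intro s hs hP
    obtain ⟨t', s', ht', hs', h1⟩ := simp_step hs (hP t (by simp))
    obtain ⟨Qs, s'', hQ, hs'', h2⟩ := ih s' hs' (fun p hp => hP p (by simp [hp]))
    refine ⟨t' :: Qs, s'', by simpa using ⟨ht', hQ⟩, hs'', ?_⟩
    have a1 := step_ctx h1 [] Ps.flatten
    have a2 := step_ctx h2 t' []
    simp at a1 a2 ⊢
    exact a1.trans a2

theorem simp_single {n : ℕ} (i : Fin (n - 1)) : Simp ([(i, true)] : BWord n) := by
  refine ⟨by simp, ?_⟩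
  simp [Valid, Asc]

theorem exists_blocks {n : ℕ} (w : BWord n) : ∃ (Ps : List (BWord n)) (v : BWord n),
    (∀ p ∈ Ps, Simp p) ∧ (∀ x ∈ v, x.2 = false) ∧
      Relation.ReflTransGen Redr1 w (Ps.flatten ++ v) := by
  induction w with
  | nil => exact ⟨[], [], by simp, by simp, .refl⟩
  | cons x w ih =>
    obtain ⟨Ps, v, hP, hv, h⟩ := ih
    obtain ⟨i, b⟩ := x
    have h0 := step_ctx h [(i, b)] []
    cases b
    · obtain ⟨Qs, s', hQ, hs', h1⟩ := simp_list Ps _ (simp_single i) hP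
      refine ⟨Qs, inv s' ++ v, hQ, ?_, ?_⟩
      · intro x hx
        rcases List.mem_append.1 hx with hx | hx
        · exact inv_neg hs'.1 x hx
        · exact hv x hx
      · have h2 := step_ctx h1 [] v
        simp [inv] at h0 h2 ⊢
        exact h0.trans h2
    · refine ⟨[(i, true)] :: Ps, v, by simpa using ⟨simp_single i, hP⟩, hv, ?_⟩
      simpa using h0

theorem exists_split {n : ℕ} (w : BWord n) : ∃ (u v : BWord n),
    (∀ x ∈ u, x.2 = true) ∧ (∀ x ∈ v, x.2 = false) ∧
      Relation.ReflTransGen Redr1 w (u ++ v) := by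
  obtain ⟨Ps, v, hP, hv, h⟩ := exists_blocks w
  refine ⟨Ps.flatten, v, ?_, hv, h⟩
  intro x hx
  obtain ⟨p, hp, hx⟩ := List.mem_flatten.1 hx
  exact (hP p hp).1 x hx

theorem neg_eq_inv {n : ℕ} {v : BWord n} (hv : ∀ x ∈ v, x.2 = true) :
    v.reverse.map (fun x => (x.1, false)) = inv v := by
  rw [inv, ← List.map_reverse]
  refine List.map_congr_left fun x hx => ?_
  rw [hv x (by simpa using hx)]; rfl

end Redr

/-- Right redressing: for every braid word `w` there are unique positive words
`u, v` such that `w` right-redresses to `u v⁻¹`; in particular redressing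
terminates. -/
theorem redressing_unique (n : ℕ) (w : BWord n) :
    ∃! p : BWord n × BWord n,
      (∀ x ∈ p.1, x.2 = true) ∧ (∀ x ∈ p.2, x.2 = true) ∧
      Relation.ReflTransGen Redr1 w
        (p.1 ++ p.2.reverse.map (fun x => (x.1, false))) := by
  obtain ⟨u, v, hu, hv, h⟩ := Redr.exists_split w
  refine ⟨(u, Redr.inv v), ⟨hu, Redr.inv_pos hv, ?_⟩, ?_⟩
  · rw [Redr.neg_eq_inv (Redr.inv_pos hv), Redr.inv_inv]
    exact h
  · rintro ⟨a, b⟩ ⟨ha, hb, hab⟩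
    simp only at ha hb hab
    rw [Redr.neg_eq_inv hb] at hab
    obtain ⟨d, h1, h2⟩ := Relation.church_rosser Redr.diamond h hab
    have e1 := Redr.normal_star hu hv h1
    have e2 := Redr.normal_star ha (Redr.inv_neg hb) h2
    obtain ⟨rfl, rfl⟩ := Redr.split_unique ha (Redr.inv_neg hb) hu hv (e2.symm.trans e1)
    rw [Redr.inv_inv]
end

section
/- The Dynnikov action is a well-defined right action of B_n on Z^{2n}: the update maps F and F̄ (giving the action of σ_i and σ_i⁻¹ on coordinates (a_i, b_i, a_{i+1}, b_{i+1})) are mutually inverse bijections of Z^4, and the resulting action of the generators satisfies the braid relations, so that equivalent braid words induce the same transformation of Z^{2n}. -/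
/-- The Dynnikov update map `F` (action of a positive letter `σ_i` on the four
coordinates `(x_1, y_1, x_2, y_2)`). -/
def dynF (p : ℤ × ℤ × ℤ × ℤ) : ℤ × ℤ × ℤ × ℤ :=
  let x1 := p.1; let y1 := p.2.1; let x2 := p.2.2.1; let y2 := p.2.2.2
  let z1 := x1 - min y1 0 - x2 + max y2 0
  (x1 + max y1 0 + max (max y2 0 - z1) 0,
   y2 - max z1 0,
   x2 + min y2 0 + min (min y1 0 + z1) 0,
   y1 + max z1 0)

/-- The Dynnikov update map `F̄` (action of a negative letter `σ_i⁻¹`). -/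
def dynG (p : ℤ × ℤ × ℤ × ℤ) : ℤ × ℤ × ℤ × ℤ :=
  let x1 := p.1; let y1 := p.2.1; let x2 := p.2.2.1; let y2 := p.2.2.2
  let z2 := x1 + min y1 0 - x2 - max y2 0
  (x1 - max y1 0 - max (max y2 0 + z2) 0,
   y2 + min z2 0,
   x2 - min y2 0 - min (min y1 0 - z2) 0,
   y1 - min z2 0)

/-- Action of the letter `σ_i^{±1}` on Dynnikov coordinates in `ℤ^{2n}`. -/
def dynStep {n : ℕ} (i : Fin (n - 1)) (e : Bool) (c : Fin n → ℤ × ℤ) :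
    Fin n → ℤ × ℤ :=
  let q := (if e then dynF else dynG)
      ((c (finL i)).1, (c (finL i)).2, (c (finR i)).1, (c (finR i)).2)
  fun k => if k = finL i then (q.1, q.2.1)
    else if k = finR i then (q.2.2.1, q.2.2.2) else c k

/-- Action of a braid word on Dynnikov coordinates, letter by letter. -/
def dynAct {n : ℕ} (w : BWord n) (c : Fin n → ℤ × ℤ) : Fin n → ℤ × ℤ :=
  w.foldl (fun c x => dynStep x.1 x.2 c) c

section
variable {K : Type*} [Semifield K]
def q1 (a b c d : K) : K := a * (1 + b) + b * c
def q2 (a b c d : K) : K := b * c * d / (b * c + a * (1 + b) * (1 + d))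
def q3 (a b c d : K) : K := a * c * d / (c + a * (1 + d))
def q4 (a b c d : K) : K := (b * c + a * (1 + b) * (1 + d)) / c


theorem q24 (H : ∀ x y : K, x + y = 0 ↔ x = 0 ∧ y = 0) (a b c d : K)
   (ha : a ≠ 0) (hb : b ≠ 0) (hc : c ≠ 0) (hd : d ≠ 0) :
   q2 a b c d * q4 a b c d = b * d := by
  simp only [q2, q4]
  have : b * c + a * (1 + b) * (1 + d) ≠ 0 := by simp [H, *]
  field_simp

theorem q_ne (H : ∀ x y : K, x + y = 0 ↔ x = 0 ∧ y = 0) (a b c d : K)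
   (ha : a ≠ 0) (hb : b ≠ 0) (hc : c ≠ 0) (hd : d ≠ 0) :
   q1 a b c d ≠ 0 ∧ q2 a b c d ≠ 0 ∧ q3 a b c d ≠ 0 ∧ q4 a b c d ≠ 0 := by
  simp [q1, q2, q3, q4, H, *]


theorem braidK3 (H : ∀ x y : K, x + y = 0 ↔ x = 0 ∧ y = 0) (a b c d e f : K)
   (ha : a ≠ 0) (hb : b ≠ 0) (hc : c ≠ 0) (hd : d ≠ 0) (he : e ≠ 0) (hf : f ≠ 0) :
   ∀ a1 b1 c1 d1, a1 = q1 a b c d → b1 = q2 a b c d → c1 = q3 a b c d → d1 = q4 a b c d →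
   ∀ c2 d2, c2 = q1 c1 d1 e f → d2 = q2 c1 d1 e f →
   ∀ c1' d1' e1' f1', c1' = q1 c d e f → d1' = q2 c d e f → e1' = q3 c d e f → f1' = q4 c d e f →
   ∀ c2' d2', c2' = q3 a b c1' d1' → d2' = q4 a b c1' d1' →
   q3 a1 b1 c2 d2 = q1 c2' d2' e1' f1' := by
  intro a1 b1 c1 d1 h1 h2 h3 h4 c2 d2 h5 h6 c1' d1' e1' f1' h9 h10 h11 h12 c2' d2' h15 h16
  simp only [q1,q2,q3,q4] at *
  obtain ⟨N, hN⟩ : ∃ N, N = b * c + a * (1 + b) * (1 + d) := ⟨_, rfl⟩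
  obtain ⟨N', hN'⟩ : ∃ N', N' = d * e + c * (1 + d) * (1 + f) := ⟨_, rfl⟩
  obtain ⟨P, hP⟩ : ∃ P, P = c + a * (1 + d) := ⟨_, rfl⟩
  obtain ⟨P', hP'⟩ : ∃ P', P' = e + c * (1 + f) := ⟨_, rfl⟩
  obtain ⟨W, hW⟩ : ∃ W, W = N * e + a * c * d * (1 + b) * (1 + f) := ⟨_, rfl⟩
  have nN : N ≠ 0 := by simp [hN, H, *]
  have nN' : N' ≠ 0 := by simp [hN', H, *]
  have nP : P ≠ 0 := by simp [hP, H, *]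
  have nP' : P' ≠ 0 := by simp [hP', H, *]
  have nW : W ≠ 0 := by simp [hW, H, nN, he]
  have na1 : a1 ≠ 0 := by simp [h1, H, *]
  have nc1' : c1' ≠ 0 := by simp [h9, H, *]
  rw [← hN] at h2 h4
  rw [← hP] at h3
  rw [← hN'] at h10 h12
  rw [← hP'] at h11
  have k1 : 1 + d1 = (1 + b) * P / c := by
    rw [h4, hN, hP]; field_simp; ring
  have k2 : c2 = (a * c * d * (1 + b) + N * e) / c := by
    rw [h5, k1, h3, h4]; field_simp
  have nc2 : a * c * d * (1 + b) + N * e ≠ 0 := by simp [H, nN, he]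
  have k3 : d2 = N * e * f / W := by
    have : d1 * e + c1 * (1 + d1) * (1 + f) = W / c := by
      rw [k1, h3, h4, hW]; field_simp
    rw [h6, this, h4]; field_simp
  have k4 : 1 + d2 = (1 + f) * c2 * c / W := by
    rw [k3, k2, eq_div_iff nW, add_mul, div_mul_cancel₀ _ nW, mul_assoc (1 + f),
      div_mul_cancel₀ _ hc, hW]; ring
  have nc2' : c2 ≠ 0 := by rw [k2]; exact div_ne_zero nc2 hc
  have k5 : W + a1 * (1 + f) * c = N * P' := by
    rw [hW, h1, hP', hN]; ring
  have k6 : c2 + a1 * (1 + d2) = c2 * (N * P') / W := by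
    rw [k4, ← k5]; field_simp
  have k7 : a1 * c2 * d2 / (c2 + a1 * (1 + d2)) = a1 * e * f / P' := by
    rw [k6, k3]; field_simp
  have m1 : 1 + d1' = (1 + f) * c1' / N' := by
    rw [h10, h9, eq_div_iff nN', add_mul, div_mul_cancel₀ _ nN', hN']; ring
  have nQ : N' + a * (1 + f) ≠ 0 := by simp [H, nN']
  have m2 : c2' = a * d * e * f / (N' + a * (1 + f)) := by
    have : c1' + a * (1 + d1') = c1' * (N' + a * (1 + f)) / N' := by
      rw [m1]; field_simp
    rw [h15, this, h10]; field_simp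
  have m3 : d2' = (b * N' + a * (1 + b) * (1 + f)) / N' := by
    rw [h16, m1]; field_simp
  have m4 : 1 + d2' = (1 + b) * (N' + a * (1 + f)) / N' := by
    rw [m3, eq_div_iff nN', add_mul, div_mul_cancel₀ _ nN']; ring
  rw [k7, m4, m2, m3, h11]
  field_simp
  rw [h1, hP', hN']; ring

set_option maxHeartbeats 1000000 in
theorem braidK (H : ∀ x y : K, x + y = 0 ↔ x = 0 ∧ y = 0) (a b c d e f : K)
   (ha : a ≠ 0) (hb : b ≠ 0) (hc : c ≠ 0) (hd : d ≠ 0) (he : e ≠ 0) (hf : f ≠ 0) :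
   ∀ a1 b1 c1 d1, a1 = q1 a b c d → b1 = q2 a b c d → c1 = q3 a b c d → d1 = q4 a b c d →
   ∀ c2 d2 e2 f2, c2 = q1 c1 d1 e f → d2 = q2 c1 d1 e f → e2 = q3 c1 d1 e f → f2 = q4 c1 d1 e f →
   ∀ c1' d1' e1' f1', c1' = q1 c d e f → d1' = q2 c d e f → e1' = q3 c d e f → f1' = q4 c d e f →
   ∀ a2 b2 c2' d2', a2 = q1 a b c1' d1' → b2 = q2 a b c1' d1' → c2' = q3 a b c1' d1' → d2' = q4 a b c1' d1' →
   q1 a1 b1 c2 d2 = a2 ∧ q2 a1 b1 c2 d2 = b2 ∧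
   q3 a1 b1 c2 d2 = q1 c2' d2' e1' f1' ∧ q4 a1 b1 c2 d2 = q2 c2' d2' e1' f1' ∧
   e2 = q3 c2' d2' e1' f1' ∧ f2 = q4 c2' d2' e1' f1' := by
  intro a1 b1 c1 d1 h1 h2 h3 h4 c2 d2 e2 f2 h5 h6 h7 h8 c1' d1' e1' f1' h9 h10 h11 h12
    a2 b2 c2' d2' h13 h14 h15 h16
  obtain ⟨na1, nb1, nc1, nd1⟩ := q_ne H a b c d ha hb hc hd
  rw [← h1] at na1; rw [← h2] at nb1; rw [← h3] at nc1; rw [← h4] at nd1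
  obtain ⟨nc2, nd2, ne2, nf2⟩ := q_ne H c1 d1 e f nc1 nd1 he hf
  rw [← h5] at nc2; rw [← h6] at nd2; rw [← h7] at ne2; rw [← h8] at nf2
  obtain ⟨nc1', nd1', ne1', nf1'⟩ := q_ne H c d e f hc hd he hf
  rw [← h9] at nc1'; rw [← h10] at nd1'; rw [← h11] at ne1'; rw [← h12] at nf1'
  obtain ⟨na2, nb2, nc2', nd2'⟩ := q_ne H a b c1' d1' ha hb nc1' nd1'
  rw [← h13] at na2; rw [← h14] at nb2; rw [← h15] at nc2'; rw [← h16] at nd2'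
  have p1 := q24 H a b c d ha hb hc hd
  have p2 := q24 H c1 d1 e f nc1 nd1 he hf
  have p3 := q24 H c d e f hc hd he hf
  have p4 := q24 H a b c1' d1' ha hb nc1' nd1'
  have p5 := q24 H a1 b1 c2 d2 na1 nb1 nc2 nd2
  have p6 := q24 H c2' d2' e1' f1' nc2' nd2' ne1' nf1'
  rw [← h2, ← h4] at p1
  rw [← h6, ← h8] at p2
  rw [← h10, ← h12] at p3
  rw [← h14, ← h16] at p4
  have nX := (q_ne H a1 b1 c2 d2 na1 nb1 nc2 nd2).2.1
  have g2 : q2 a1 b1 c2 d2 = b2 := by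
    clear p1 p2 p3 p4 p5 p6
    simp only [q1,q2,q3,q4] at *
    subst h1 h2 h3 h4 h5 h6 h7 h8 h9 h10 h11 h12 h13 h14 h15 h16
    field_simp (disch := simp [H, *])
    try ring
  have g6 : f2 = q4 c2' d2' e1' f1' := by
    clear p1 p2 p3 p4 p5 p6
    simp only [q1,q2,q3,q4] at *
    subst h1 h2 h3 h4 h5 h6 h7 h8 h9 h10 h11 h12 h13 h14 h15 h16
    field_simp (disch := simp [H, *])
    try ring
  have g1 : q1 a1 b1 c2 d2 = a2 := by
    clear p1 p2 p3 p4 p5 p6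
    simp only [q1,q2,q3,q4] at *
    subst h1 h2 h3 h4 h5 h6 h7 h8 h9 h10 h11 h12 h13 h14 h15 h16
    field_simp (disch := simp [H, *])
    try ring
  have g5 : e2 = q3 c2' d2' e1' f1' := by
    clear p1 p2 p3 p4 p5 p6
    simp only [q1,q2,q3,q4] at *
    subst h1 h2 h3 h4 h5 h6 h7 h8 h9 h10 h11 h12 h13 h14 h15 h16
    field_simp (disch := simp [H, *])
    try ring
  refine ⟨g1, g2, ?_, ?_, g5, g6⟩
  · exact braidK3 H a b c d e f ha hb hc hd he hf a1 b1 c1 d1 h1 h2 h3 h4 c2 d2 h5 h6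
      c1' d1' e1' f1' h9 h10 h11 h12 c2' d2' h15 h16
  · rw [← g6] at p6
    rw [g2] at p5
    apply mul_left_cancel₀ (mul_ne_zero nb2 nf2)
    calc b2 * f2 * q4 a1 b1 c2 d2 = (b2 * q4 a1 b1 c2 d2) * f2 := by ring
      _ = b1 * (d2 * f2) := by rw [p5]; ring
      _ = (b1 * d1) * f := by rw [p2]; ring
      _ = b * (d * f) := by rw [p1]; ring
      _ = (b * d1') * f1' := by rw [← p3]; ring
      _ = b2 * (d2' * f1') := by rw [← p4]; ring
      _ = _ := by rw [← p6]; ring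
end
abbrev TT := Tropical (WithTop ℤ)
noncomputable instance : Semifield TT where
  inv x := Tropical.trop (-(Tropical.untrop x))
  inv_zero := by
    apply Tropical.untrop_injective
    rfl
  mul_inv_cancel x hx := by
    apply Tropical.untrop_injective
    have : Tropical.untrop x ≠ ⊤ := fun h => hx (Tropical.untrop_injective h)
    exact LinearOrderedAddCommGroupWithTop.add_neg_cancel_of_ne_top this
  div_eq_mul_inv x y := by
    apply Tropical.untrop_injective
    exact sub_eq_add_neg _ _
  nnqsmul := _
  nnqsmul_def _ _ := rfl
noncomputable def phi (x : ℤ) : TT := Tropical.trop ((-x : ℤ) : WithTop ℤ)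
theorem phi_inj {x y} (h : phi x = phi y) : x = y := by
  have := Tropical.trop_injective h
  have := WithTop.coe_injective this
  omega
theorem phi_add (x y) : phi (x+y) = phi x * phi y := by
  unfold phi
  rw [← Tropical.trop_add, ← WithTop.coe_add]
  congr 2; ring
theorem phi_zero : phi 0 = 1 := rfl
theorem phi_ne (x) : phi x ≠ 0 := fun h => by
  have := Tropical.trop_injective h
  exact WithTop.coe_ne_top this
theorem phi_sub (x y) : phi (x-y) = phi x / phi y := by
  rw [eq_div_iff (phi_ne y), ← phi_add]; simp
theorem phi_max (x y) : phi (max x y) = phi x + phi y := by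
  unfold phi
  rw [← Tropical.trop_inf, ← WithTop.coe_min]
  congr 2; omega
theorem TH (x y : TT) : x + y = 0 ↔ x = 0 ∧ y = 0 := by
  simp

theorem dynF_eq (x1 y1 x2 y2 : ℤ) :
    dynF (x1, y1, x2, y2) =
      (max (x1 + max 0 y1) (y1 + x2),
       y1 + x2 + y2 - max (y1 + x2) (x1 + max 0 y1 + max 0 y2),
       x1 + x2 + y2 - max x2 (x1 + max 0 y2),
       max (y1 + x2) (x1 + max 0 y1 + max 0 y2) - x2) := by
  simp only [dynF, Prod.mk.injEq]
  refine ⟨?_, ?_, ?_, ?_⟩ <;> omega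

theorem phi_F (x1 y1 x2 y2 : ℤ) :
    phi (dynF (x1, y1, x2, y2)).1 = q1 (phi x1) (phi y1) (phi x2) (phi y2) ∧
    phi (dynF (x1, y1, x2, y2)).2.1 = q2 (phi x1) (phi y1) (phi x2) (phi y2) ∧
    phi (dynF (x1, y1, x2, y2)).2.2.1 = q3 (phi x1) (phi y1) (phi x2) (phi y2) ∧
    phi (dynF (x1, y1, x2, y2)).2.2.2 = q4 (phi x1) (phi y1) (phi x2) (phi y2) := by
  simp only [dynF_eq, phi_max, phi_add, phi_sub, phi_zero, q1, q2, q3, q4, and_self]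

theorem dynGF (p : ℤ × ℤ × ℤ × ℤ) : dynG (dynF p) = p := by
  obtain ⟨a, b, c, d⟩ := p
  simp only [dynF, dynG, Prod.mk.injEq]
  refine ⟨?_, ?_, ?_, ?_⟩ <;> omega

theorem dynFG (p : ℤ × ℤ × ℤ × ℤ) : dynF (dynG p) = p := by
  obtain ⟨a, b, c, d⟩ := p
  simp only [dynF, dynG, Prod.mk.injEq]
  refine ⟨?_, ?_, ?_, ?_⟩ <;> omega

/-- The braid relation on `ℤ^6`. -/
theorem braidZ (a b c d e f : ℤ) :
    let u := dynF (a, b, c, d)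
    let v := dynF (u.2.2.1, u.2.2.2, e, f)
    let l := dynF (u.1, u.2.1, v.1, v.2.1)
    let u' := dynF (c, d, e, f)
    let v' := dynF (a, b, u'.1, u'.2.1)
    let l' := dynF (v'.2.2.1, v'.2.2.2, u'.2.2.1, u'.2.2.2)
    l.1 = v'.1 ∧ l.2.1 = v'.2.1 ∧ l.2.2.1 = l'.1 ∧ l.2.2.2 = l'.2.1 ∧
      v.2.2.1 = l'.2.2.1 ∧ v.2.2.2 = l'.2.2.2 := by
  intro u v l u' v' l'
  obtain ⟨h1, h2, h3, h4⟩ := phi_F a b c d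
  obtain ⟨h5, h6, h7, h8⟩ := phi_F u.2.2.1 u.2.2.2 e f
  obtain ⟨h9, h10, h11, h12⟩ := phi_F c d e f
  obtain ⟨h13, h14, h15, h16⟩ := phi_F a b u'.1 u'.2.1
  obtain ⟨g1, g2, g3, g4⟩ := phi_F u.1 u.2.1 v.1 v.2.1
  obtain ⟨g5, g6, g7, g8⟩ := phi_F v'.2.2.1 v'.2.2.2 u'.2.2.1 u'.2.2.2
  obtain ⟨r1, r2, r3, r4, r5, r6⟩ := braidK TH (phi a) (phi b) (phi c) (phi d) (phi e) (phi f)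
    (phi_ne _) (phi_ne _) (phi_ne _) (phi_ne _) (phi_ne _) (phi_ne _)
    _ _ _ _ h1 h2 h3 h4 _ _ _ _ h5 h6 h7 h8 _ _ _ _ h9 h10 h11 h12 _ _ _ _ h13 h14 h15 h16
  exact ⟨phi_inj (g1.trans r1), phi_inj (g2.trans r2), phi_inj (g3.trans (r3.trans g5.symm)),
    phi_inj (g4.trans (r4.trans g6.symm)), phi_inj (r5.trans g7.symm),
    phi_inj (r6.trans g8.symm)⟩

theorem finLR {n : ℕ} (i : Fin (n - 1)) : finR i ≠ finL i := by
  simp [finL, finR, Fin.ext_iff]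

theorem step_inv {n : ℕ} (i : Fin (n - 1)) (e : Bool) (c : Fin n → ℤ × ℤ) :
    dynStep i (!e) (dynStep i e c) = c := by
  funext k
  have h := finLR i
  by_cases h1 : k = finL i
  · subst h1
    cases e <;> simp [dynStep, h, dynGF, dynFG]
  · by_cases h2 : k = finR i
    · subst h2
      cases e <;> simp [dynStep, h, dynGF, dynFG]
    · simp [dynStep, h1, h2]

/-- The positive step as a function of two positions. -/
def st {n : ℕ} (p q : Fin n) (c : Fin n → ℤ × ℤ) : Fin n → ℤ × ℤ := fun k =>
  if k = p then ((dynF ((c p).1, (c p).2, (c q).1, (c q).2)).1,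
      (dynF ((c p).1, (c p).2, (c q).1, (c q).2)).2.1)
  else if k = q then ((dynF ((c p).1, (c p).2, (c q).1, (c q).2)).2.2.1,
      (dynF ((c p).1, (c p).2, (c q).1, (c q).2)).2.2.2)
  else c k

theorem step_st {n : ℕ} (i : Fin (n - 1)) (c : Fin n → ℤ × ℤ) :
    dynStep i true c = st (finL i) (finR i) c := by
  rfl

theorem st_braid {n : ℕ} (p q r : Fin n) (hpq : p ≠ q) (hpr : p ≠ r) (hqr : q ≠ r)
    (c : Fin n → ℤ × ℤ) : st p q (st q r (st p q c)) = st q r (st p q (st q r c)) := by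
  obtain ⟨r1, r2, r3, r4, r5, r6⟩ := braidZ (c p).1 (c p).2 (c q).1 (c q).2 (c r).1 (c r).2
  funext k
  by_cases h1 : k = p
  · subst h1
    simp [st, hpq, hpr, hqr, hpq.symm, hpr.symm, hqr.symm, r1, r2]
  by_cases h2 : k = q
  · subst h2
    simp [st, hpq, hpr, hqr, hpq.symm, hpr.symm, hqr.symm, r3, r4]
  by_cases h3 : k = r
  · subst h3
    simp [st, hpq, hpr, hqr, hpq.symm, hpr.symm, hqr.symm, r5, r6]
  simp [st, h1, h2, h3]

theorem st_comm {n : ℕ} (p q r s : Fin n) (hpr : p ≠ r) (hps : p ≠ s)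
    (hqr : q ≠ r) (hqs : q ≠ s) (c : Fin n → ℤ × ℤ) :
    st p q (st r s c) = st r s (st p q c) := by
  funext k
  by_cases h1 : k = p
  · subst h1
    simp [st, hpr, hps, hqr, hqs]
  by_cases h2 : k = q
  · subst h2
    simp [st, hpr, hps, hqr, hqs]
  simp [st, h1, h2, hpr.symm, hps.symm, hqr.symm, hqs.symm]

/-- The inverse letter as a permutation of the coordinates. -/
def stepPerm {n : ℕ} (i : Fin (n - 1)) : Equiv.Perm (Fin n → ℤ × ℤ) where
  toFun := dynStep i true
  invFun := dynStep i false
  left_inv := step_inv i true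
  right_inv := step_inv i false

theorem stepPerm_rels (n : ℕ) : ∀ r ∈ braidRels n,
    FreeGroup.lift (fun i : Fin (n - 1) => (stepPerm i)⁻¹) r = 1 := by
  rintro r (⟨i, j, hij, rfl⟩ | ⟨i, j, hij, rfl⟩)
  · have h : stepPerm j * stepPerm i = stepPerm i * stepPerm j := by
      ext1 c
      change dynStep j true (dynStep i true c) = dynStep i true (dynStep j true c)
      simp only [step_st]
      apply st_comm <;> simp only [finL, finR, ne_eq, Fin.ext_iff] <;> omega
    simp only [map_mul, map_inv, FreeGroup.lift_apply_of, ← mul_inv_rev, h]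
    simp
  · have h : stepPerm i * (stepPerm j * stepPerm i) = stepPerm j * (stepPerm i * stepPerm j) := by
      ext1 c
      change dynStep i true (dynStep j true (dynStep i true c)) =
        dynStep j true (dynStep i true (dynStep j true c))
      simp only [step_st]
      have e : finL j = finR i := by simp only [finL, finR, Fin.ext_iff]; omega
      rw [e]
      apply st_braid <;> simp only [finL, finR, ne_eq, Fin.ext_iff] <;> omega
    simp only [map_mul, map_inv, FreeGroup.lift_apply_of, ← mul_inv_rev, h]
    simp

/-- The action as a group homomorphism (to inverses). -/
def actHom (n : ℕ) : BraidGroup n →* Equiv.Perm (Fin n → ℤ × ℤ) :=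
  PresentedGroup.toGroup (stepPerm_rels n)

theorem actHom_gen {n : ℕ} (i : Fin (n - 1)) : actHom n (braidGen i) = (stepPerm i)⁻¹ :=
  PresentedGroup.toGroup.of (stepPerm_rels n)

theorem dynAct_eq {n : ℕ} (w : BWord n) (c : Fin n → ℤ × ℤ) :
    dynAct w c = (actHom n (evalWord w))⁻¹ c := by
  induction w generalizing c with
  | nil => simp [dynAct, evalWord]
  | cons x w ih =>
    obtain ⟨i, e⟩ := x
    have h1 : dynAct ((i, e) :: w) c = dynAct w (dynStep i e c) := rfl
    have h2 : evalWord ((i, e) :: w) =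
        (if e then braidGen i else (braidGen i)⁻¹) * evalWord w := by
      simp [evalWord]
    rw [h1, ih, h2, map_mul, mul_inv_rev, Equiv.Perm.mul_apply]
    congr 1
    cases e
    · simp only [Bool.false_eq_true, if_false, map_inv, actHom_gen, inv_inv]
      rfl
    · simp only [if_true, actHom_gen, inv_inv]
      rfl

/-- The Dynnikov action is a well-defined right action of `B_n` on `ℤ^{2n}` :
the update maps `F` and `F̄` are mutually inverse bijections of `ℤ^4`, and
equivalent braid words induce the same transformation of `ℤ^{2n}`. -/
theorem dynnikov_well_defined (n : ℕ) :
    (∀ p : ℤ × ℤ × ℤ × ℤ, dynG (dynF p) = p ∧ dynF (dynG p) = p) ∧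
    (∀ w w' : BWord n, evalWord w = evalWord w' →
      dynAct w = dynAct (n := n) w') := by
  refine ⟨fun p => ⟨dynGF p, dynFG p⟩, fun w w' h => ?_⟩
  funext c
  rw [dynAct_eq, dynAct_eq, h]
end
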